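/- arXiv:0901.3580 — 9 statements merged into one kernel-verified Lean document; each statement's English description precedes it below -/
import Mathlib

section
/- For all real SNR, INR > 0, let C̄(SNR,INR) = (1/2)·sup_{ρ∈[0,1]} [ log₂(1 + (1−ρ²)·SNR/(1+(1−ρ²)·INR)) + log₂(1 + SNR + INR + 2ρ·√(SNR·INR)) ], and define the achievable symmetric rate R(SNR,INR) piecewise by: R = (1/2)·log₂(1+INR) if INR ≥ SNR; R = log₂(1 + SNR/(2·INR)) + (1/2)·log₂(1+INR) − 1/2 if 1 ≤ INR ≤ SNR; and R = log₂(1 + SNR/(INR+1)) if INR ≤ 1 and INR ≤ SNR. Then C̄(SNR,INR) − R(SNR,INR) ≤ 5/2 − (1/2)·log₂ 3 (≈ 1.7075). -/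
open Real

/-- The outer bound on the symmetric capacity of the Gaussian interference
channel with feedback (Theorem 3). -/
noncomputable def outerBound (SNR INR : ℝ) : ℝ :=
  (1 / 2) * ⨆ ρ : Set.Icc (0 : ℝ) 1,
    (Real.logb 2 (1 + (1 - (ρ : ℝ) ^ 2) * SNR / (1 + (1 - (ρ : ℝ) ^ 2) * INR)) +
      Real.logb 2 (1 + SNR + INR + 2 * (ρ : ℝ) * Real.sqrt (SNR * INR)))

/-- The achievable symmetric rate of the proposed two-staged feedback
scheme (Theorem 2). -/
noncomputable def achievableRate (SNR INR : ℝ) : ℝ :=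
  if SNR ≤ INR then (1 / 2) * Real.logb 2 (1 + INR)
  else if 1 ≤ INR then
    Real.logb 2 (1 + SNR / (2 * INR)) + (1 / 2) * Real.logb 2 (1 + INR) - 1 / 2
  else Real.logb 2 (1 + SNR / (INR + 1))

/-- The supremum is controlled by taking `ρ = 0` in the first factor and `ρ = 1` in the second. -/
theorem outerBound_le_logb {S I : ℝ} (hS : 0 < S) (hI : 0 < I) :
    outerBound S I ≤
      (1 / 2) * Real.logb 2 ((1 + S / (1 + I)) * (1 + S + I + 2 * √(S * I))) := by
  unfold outerBound
  have hsqrt := Real.sqrt_nonneg (S * I)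
  gcongr
  apply ciSup_le
  rintro ⟨ρ, hρ0, hρ1⟩
  have hx0 : 0 ≤ 1 - ρ ^ 2 := by nlinarith
  have hx1 : 1 - ρ ^ 2 ≤ 1 := by nlinarith
  dsimp only
  generalize 1 - ρ ^ 2 = x at hx0 hx1
  have hfirst : x * S / (1 + x * I) ≤ S / (1 + I) := by
    rw [div_le_div_iff₀ (by positivity) (by positivity)]
    nlinarith [mul_le_mul_of_nonneg_right hx1 hS.le]
  rw [Real.logb_mul (by positivity) (by positivity)]
  refine add_le_add
    (Real.logb_le_logb_of_le one_lt_two (by positivity) (by linarith))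
    (Real.logb_le_logb_of_le one_lt_two (by positivity) ?_)
  nlinarith

/-- A multiplicative comparison with the squared exponential rate `P` yields the gap in bits. -/
theorem outerBound_sub_logb_le {S I P : ℝ} (hS : 0 < S) (hI : 0 < I) (hP : 0 < P)
    (h : 3 * ((1 + S / (1 + I)) * (1 + S + I + 2 * √(S * I))) ≤ 32 * P) :
    outerBound S I - (1 / 2) * Real.logb 2 P ≤ 5 / 2 - (1 / 2) * Real.logb 2 3 := by
  have hlog := Real.logb_le_logb_of_le one_lt_two (by positivity) h
  have h32 : Real.logb 2 32 = 5 := by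
    rw [show (32 : ℝ) = 2 ^ (5 : ℝ) by norm_num, Real.logb_rpow two_pos (by norm_num)]
  rw [Real.logb_mul (by norm_num) (by positivity), Real.logb_mul (by norm_num) hP.ne', h32] at hlog
  linarith [outerBound_le_logb hS hI]

theorem two_mul_sqrt_mul_le_add {S I : ℝ} (hS : 0 ≤ S) (hI : 0 ≤ I) :
    2 * √(S * I) ≤ S + I := by
  rw [Real.sqrt_mul hS]
  nlinarith [sq_nonneg (√S - √I), Real.sq_sqrt hS, Real.sq_sqrt hI]

theorem three_mul_add_mul_sqrt_sum_sq_le {S I : ℝ} (hS : 0 ≤ S) (hI : 0 ≤ I) :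
    3 * ((S + I) * (S + I + 2 * √(S * I))) ≤ 4 * (2 * I + S) ^ 2 := by
  rw [Real.sqrt_mul hS]
  obtain ⟨a, rfl⟩ : ∃ a, S = a ^ 2 := ⟨√S, (Real.sq_sqrt hS).symm⟩
  obtain ⟨b, rfl⟩ : ∃ b, I = b ^ 2 := ⟨√I, (Real.sq_sqrt hI).symm⟩
  rw [Real.sqrt_sq_eq_abs, Real.sqrt_sq_eq_abs, ← sq_abs a, ← sq_abs b]
  generalize |a| = u
  generalize |b| = v
  linarith [sq_nonneg (u ^ 2 - 3 * u * v), sq_nonneg (u * v - 3 * v ^ 2), sq_nonneg (v ^ 2)]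

/-- Theorem 4: the outer bound exceeds the achievable symmetric rate by at
most 5/2 − (1/2)·log₂ 3 ≈ 1.7075 bits, for all channel parameters. -/
theorem symmetric_capacity_gap (SNR INR : ℝ) (hSNR : 0 < SNR) (hINR : 0 < INR) :
    outerBound SNR INR - achievableRate SNR INR ≤ 5 / 2 - (1 / 2) * Real.logb 2 3 := by
  have hsqrt := Real.sqrt_nonneg (SNR * INR)
  have hamgm := two_mul_sqrt_mul_le_add hSNR.le hINR.le
  unfold achievableRate
  split_ifs with hle hone
  · apply outerBound_sub_logb_le hSNR hINR (by positivity)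
    have hA : 1 + SNR / (1 + INR) ≤ 2 := by
      have : SNR / (1 + INR) ≤ 1 := by
        rw [div_le_one (by positivity)]
        linarith
      linarith
    have hB : 1 + SNR + INR + 2 * √(SNR * INR) ≤ 4 * (1 + INR) := by linarith
    have := mul_le_mul hA hB (by positivity) (by norm_num)
    linarith
  · have hrate : Real.logb 2 (1 + SNR / (2 * INR)) + (1 / 2) * Real.logb 2 (1 + INR) - 1 / 2 =
        (1 / 2) * Real.logb 2 ((1 + SNR / (2 * INR)) ^ 2 * (1 + INR) / 2) := by
      rw [Real.logb_div (by positivity) (by norm_num), Real.logb_mul (by positivity) (by positivity),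
        Real.logb_pow, Real.logb_self_eq_one one_lt_two]
      push_cast
      ring
    rw [hrate]
    apply outerBound_sub_logb_le hSNR hINR (by positivity)
    have hA : INR * (1 + INR + SNR) ≤ (1 + INR) * (SNR + INR) := by nlinarith
    have hB : INR * (1 + SNR + INR + 2 * √(SNR * INR)) ≤
        (1 + INR) * (SNR + INR + 2 * √(SNR * INR)) := by nlinarith
    have hAB := mul_le_mul hA hB (by positivity) (by positivity)
    have hcore := mul_le_mul_of_nonneg_left
      (three_mul_add_mul_sqrt_sum_sq_le hSNR.le hINR.le) (sq_nonneg (1 + INR))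
    rw [show 3 * ((1 + SNR / (1 + INR)) * (1 + SNR + INR + 2 * √(SNR * INR))) =
        3 * (INR * (1 + INR + SNR) * (INR * (1 + SNR + INR + 2 * √(SNR * INR)))) /
          (INR ^ 2 * (1 + INR)) by field_simp,
      show 32 * ((1 + SNR / (2 * INR)) ^ 2 * (1 + INR) / 2) =
        (1 + INR) ^ 2 * (4 * (2 * INR + SNR) ^ 2) / (INR ^ 2 * (1 + INR)) by field_simp; ring]
    refine div_le_div_of_nonneg_right ?_ (by positivity)
    linarith
  · have hrate : Real.logb 2 (1 + SNR / (INR + 1)) =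
        (1 / 2) * Real.logb 2 ((1 + SNR / (1 + INR)) ^ 2) := by
      rw [Real.logb_pow, add_comm INR]
      push_cast
      ring
    rw [hrate]
    apply outerBound_sub_logb_le hSNR hINR (by positivity)
    have hB : 3 * (1 + SNR + INR + 2 * √(SNR * INR)) ≤ 32 * (1 + SNR / (1 + INR)) := by
      rw [show 32 * (1 + SNR / (1 + INR)) = 32 * (1 + INR + SNR) / (1 + INR) by field_simp,
        le_div_iff₀ (by positivity)]
      nlinarith
    have := mul_le_mul_of_nonneg_left hB (show 0 ≤ 1 + SNR / (1 + INR) by positivity)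
    linarith
end

section
/- For all real numbers SNR ≥ INR ≥ 1 and every ρ ∈ [0,1]: log₂(1 + (1−ρ²)·SNR/(1+(1−ρ²)·INR)) + log₂(1 + SNR + INR + 2ρ·√(SNR·INR)) − 2·[ log₂(1 + SNR/(2·INR)) + (1/2)·log₂(1+INR) − 1/2 ] ≤ 2 + log₂(8/3). -/
/-- Polynomial core of the gap bound, in terms of `I = INR` and `s = √(SNR / INR)`. -/
lemma one_add_mul_one_add_le (I s : ℝ) (hI : 0 ≤ I) (hs : 0 ≤ s) :
    (1 + I * (1 + s ^ 2)) * (1 + I * (1 + s) ^ 2) ≤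
      4 / 3 * (1 + I) ^ 2 * (2 + s ^ 2) ^ 2 := by
  have ha : 1 ≤ 1 + s ^ 2 := by nlinarith
  have hb : 1 ≤ (1 + s) ^ 2 := by nlinarith
  have hab : (1 + s ^ 2) * (1 + s) ^ 2 ≤ 4 / 3 * (2 + s ^ 2) ^ 2 := by
    nlinarith [sq_nonneg (s ^ 2 - 3 * s), sq_nonneg (s - 3)]
  generalize 1 + s ^ 2 = a at *
  generalize (1 + s) ^ 2 = b at *
  have hadd : a + b ≤ 1 + a * b := by nlinarith
  have hone : 1 ≤ a * b := by nlinarith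
  calc (1 + I * a) * (1 + I * b) = 1 + I * (a + b) + I ^ 2 * (a * b) := by ring
    _ ≤ a * b + I * (2 * (a * b)) + I ^ 2 * (a * b) := by
      gcongr
      linarith
    _ = (1 + I) ^ 2 * (a * b) := by ring
    _ ≤ (1 + I) ^ 2 * (4 / 3 * (2 + s ^ 2) ^ 2) := by gcongr
    _ = 4 / 3 * (1 + I) ^ 2 * (2 + s ^ 2) ^ 2 := by ring

/-- The gap bound before taking logarithms. -/
lemma outer_mul_outer_le (S I ρ : ℝ) (hI : 0 < I) (hS : 0 ≤ S)
    (hρ0 : 0 ≤ ρ) (hρ1 : ρ ≤ 1) :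
    (1 + (1 - ρ ^ 2) * S / (1 + (1 - ρ ^ 2) * I)) * (1 + S + I + 2 * ρ * Real.sqrt (S * I)) ≤
      16 / 3 * (1 + S / (2 * I)) ^ 2 * (1 + I) := by
  obtain ⟨s, hs, rfl⟩ : ∃ s : ℝ, 0 ≤ s ∧ S = I * s ^ 2 := by
    refine ⟨Real.sqrt (S / I), Real.sqrt_nonneg _, ?_⟩
    rw [Real.sq_sqrt (by positivity)]
    field_simp
  have hsqrt : Real.sqrt (I * s ^ 2 * I) = I * s := by
    rw [show I * s ^ 2 * I = (I * s) ^ 2 by ring, Real.sqrt_sq (by positivity)]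
  have ht0 : 0 ≤ 1 - ρ ^ 2 := by nlinarith
  have hA : (1 - ρ ^ 2) * (I * s ^ 2) / (1 + (1 - ρ ^ 2) * I) ≤ I * s ^ 2 / (1 + I) := by
    rw [div_le_div_iff₀ (by positivity) (by positivity)]
    have : 0 ≤ I * s ^ 2 * ρ ^ 2 := by positivity
    linarith
  have hB : 1 + I * s ^ 2 + I + 2 * ρ * (I * s) ≤ 1 + I * (1 + s) ^ 2 := by
    have : ρ * (I * s) ≤ 1 * (I * s) := by gcongr
    linarith
  rw [hsqrt]
  calc _ ≤ (1 + I * s ^ 2 / (1 + I)) * (1 + I * (1 + s) ^ 2) := by gcongr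
    _ = (1 + I * (1 + s ^ 2)) * (1 + I * (1 + s) ^ 2) / (1 + I) := by
      field_simp
      ring
    _ ≤ 4 / 3 * (1 + I) ^ 2 * (2 + s ^ 2) ^ 2 / (1 + I) :=
      div_le_div_of_nonneg_right (one_add_mul_one_add_le I s hI.le hs) (by positivity)
    _ = _ := by
      field_simp
      ring

/-- Weak-interference-regime gap bound from the proof of Theorem 4:
for SNR ≥ INR ≥ 1 and ρ ∈ [0,1], twice the outer bound minus twice the
achievable rate is at most 2 + log₂(8/3). -/
theorem weak_regime_gap (SNR INR ρ : ℝ) (hINR : 1 ≤ INR) (hSNR : INR ≤ SNR)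
    (hρ0 : 0 ≤ ρ) (hρ1 : ρ ≤ 1) :
    Real.logb 2 (1 + (1 - ρ ^ 2) * SNR / (1 + (1 - ρ ^ 2) * INR)) +
      Real.logb 2 (1 + SNR + INR + 2 * ρ * Real.sqrt (SNR * INR)) -
      2 * (Real.logb 2 (1 + SNR / (2 * INR)) + (1 / 2) * Real.logb 2 (1 + INR) - 1 / 2) ≤
      2 + Real.logb 2 (8 / 3) := by
  have hI : 0 < INR := by linarith
  have hS : 0 < SNR := by linarith
  have ht0 : 0 ≤ 1 - ρ ^ 2 := by nlinarith
  have hA : 0 < 1 + (1 - ρ ^ 2) * SNR / (1 + (1 - ρ ^ 2) * INR) := by positivity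
  have hB : 0 < 1 + SNR + INR + 2 * ρ * Real.sqrt (SNR * INR) := by positivity
  have hC : 0 < 1 + SNR / (2 * INR) := by positivity
  have hlog := Real.logb_le_logb_of_le one_lt_two (mul_pos hA hB)
    (outer_mul_outer_le SNR INR ρ hI hS.le hρ0 hρ1)
  rw [Real.logb_mul hA.ne' hB.ne', Real.logb_mul (by positivity) (by positivity),
    Real.logb_mul (by norm_num) (by positivity), Real.logb_pow,
    show (16 / 3 : ℝ) = 2 * (8 / 3) by norm_num, Real.logb_mul (by norm_num) (by norm_num),
    Real.logb_self_eq_one one_lt_two] at hlog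
  push_cast at hlog
  linarith
end

section
/- For all real numbers INR ≥ SNR > 0 and every ρ ∈ [0,1]: log₂(1 + (1−ρ²)·SNR/(1+(1−ρ²)·INR)) + log₂(1 + SNR + INR + 2ρ·√(SNR·INR)) − log₂(1+INR) ≤ 3. -/
/-- Strong-interference-regime gap bound from the proof of Theorem 4:
for INR ≥ SNR > 0 and ρ ∈ [0,1], twice the outer bound minus twice the
achievable rate (1/2)·log₂(1+INR) is at most 3. -/
theorem strong_regime_gap (SNR INR ρ : ℝ) (hSNR : 0 < SNR) (hINR : SNR ≤ INR)
    (hρ0 : 0 ≤ ρ) (hρ1 : ρ ≤ 1) :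
    Real.logb 2 (1 + (1 - ρ ^ 2) * SNR / (1 + (1 - ρ ^ 2) * INR)) +
      Real.logb 2 (1 + SNR + INR + 2 * ρ * Real.sqrt (SNR * INR)) -
      Real.logb 2 (1 + INR) ≤ 3 := by
  have hI : 0 < INR := hSNR.trans_le hINR
  have ht : 0 ≤ 1 - ρ ^ 2 := by nlinarith
  have hfirst : (1 - ρ ^ 2) * SNR / (1 + (1 - ρ ^ 2) * INR) ≤ 1 := by
    rw [div_le_one (by positivity)]
    linarith [mul_le_mul_of_nonneg_left hINR ht]
  have hsqrt : Real.sqrt (SNR * INR) ≤ INR :=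
    Real.sqrt_le_iff.2 ⟨hI.le, by nlinarith⟩
  have hcross : ρ * Real.sqrt (SNR * INR) ≤ INR :=
    (mul_le_of_le_one_left (Real.sqrt_nonneg _) hρ1).trans hsqrt
  have hlog₁ : Real.logb 2 (1 + (1 - ρ ^ 2) * SNR / (1 + (1 - ρ ^ 2) * INR)) ≤ 1 := by
    rw [Real.logb_le_iff_le_rpow one_lt_two (by positivity), Real.rpow_one]
    linarith
  have hlog₂ : Real.logb 2 (1 + SNR + INR + 2 * ρ * Real.sqrt (SNR * INR)) ≤
      2 + Real.logb 2 (1 + INR) := by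
    rw [Real.logb_le_iff_le_rpow one_lt_two (by positivity), Real.rpow_add two_pos,
      Real.rpow_logb two_pos (by norm_num) (by positivity), Real.rpow_two]
    linarith
  linarith
end

section
/- For all real numbers SNR, INR with 0 < INR ≤ 1 and INR ≤ SNR, and every ρ ∈ [0,1]: log₂(1 + (1−ρ²)·SNR/(1+(1−ρ²)·INR)) + log₂(1 + SNR + INR + 2ρ·√(SNR·INR)) − 2·log₂(1 + SNR/(INR+1)) ≤ 2. -/
/-- Very-weak-interference case of the constant-gap result (Theorem 4):
for 0 < INR ≤ 1, INR ≤ SNR and ρ ∈ [0,1], twice the outer bound minus twice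
the achievable rate log₂(1 + SNR/(INR+1)) is at most 2. -/
theorem very_weak_regime_gap (SNR INR ρ : ℝ) (hINR0 : 0 < INR) (hINR1 : INR ≤ 1)
    (hINRSNR : INR ≤ SNR) (hρ0 : 0 ≤ ρ) (hρ1 : ρ ≤ 1) :
    Real.logb 2 (1 + (1 - ρ ^ 2) * SNR / (1 + (1 - ρ ^ 2) * INR)) +
      Real.logb 2 (1 + SNR + INR + 2 * ρ * Real.sqrt (SNR * INR)) -
      2 * Real.logb 2 (1 + SNR / (INR + 1)) ≤ 2 := by
  have hS : 0 < SNR := hINR0.trans_le hINRSNR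
  have ht0 : 0 ≤ 1 - ρ ^ 2 := by nlinarith
  have ht1 : 1 - ρ ^ 2 ≤ 1 := by nlinarith
  have hden : 0 < 1 + (1 - ρ ^ 2) * INR := by positivity
  have hC : 0 < 1 + SNR / (INR + 1) := by positivity
  have hA : 1 + (1 - ρ ^ 2) * SNR / (1 + (1 - ρ ^ 2) * INR) ≤ 1 + SNR / (INR + 1) := by
    gcongr 1 + ?_
    rw [div_le_div_iff₀ hden (by linarith)]
    nlinarith [mul_le_mul_of_nonneg_right ht1 hS.le]
  have hsqrt : 2 * ρ * Real.sqrt (SNR * INR) ≤ SNR + INR := by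
    have hamgm : 2 * Real.sqrt (SNR * INR) ≤ SNR + INR := by
      rw [Real.sqrt_mul hS.le]
      nlinarith [sq_nonneg (Real.sqrt SNR - Real.sqrt INR),
        Real.sq_sqrt hS.le, Real.sq_sqrt hINR0.le]
    nlinarith [mul_le_mul_of_nonneg_right hρ1 (Real.sqrt_nonneg (SNR * INR))]
  have hB : 1 + SNR + INR + 2 * ρ * Real.sqrt (SNR * INR) ≤ 2 ^ 2 * (1 + SNR / (INR + 1)) := by
    have hfrac : SNR / 2 ≤ SNR / (INR + 1) := by
      gcongr
      linarith
    linarith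
  have hlogA := Real.logb_le_logb_of_le one_lt_two (by positivity) hA
  have hlogB := Real.logb_le_logb_of_le one_lt_two (by positivity) hB
  have hlog4 : Real.logb 2 ((2 : ℝ) ^ 2) = 2 := by
    rw [Real.logb_pow, Real.logb_self_eq_one one_lt_two]
    norm_num
  rw [Real.logb_mul (by norm_num) hC.ne', hlog4] at hlogB
  linarith
end

section
/- Fix α ≥ 0 and for SNR > 1 define C̄(SNR) = (1/2)·sup_{ρ∈[0,1]} [ log₂(1 + (1−ρ²)·SNR/(1+(1−ρ²)·SNR^α)) + log₂(1 + SNR + SNR^α + 2ρ·SNR^{(1+α)/2}) ]. Then lim_{SNR→∞} C̄(SNR)/log₂(SNR) = max(1 − α/2, α/2). -/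
open Real Filter

/-- The logarithm of `2 ^ k * S ^ a` in base two. -/
theorem logb_two_rpow_mul_rpow {S : ℝ} (hS : 0 < S) (k a : ℝ) :
    logb 2 (2 ^ k * S ^ a) = k + a * logb 2 S := by
  rw [logb_mul (by positivity) (by positivity), logb_rpow (by norm_num) (by norm_num),
    logb_rpow_eq_mul_logb_of_pos hS]

/-- The interference-limited rate term is at most `1 + (1 - α)⁺ log₂ S`. -/
theorem logb_one_add_div_le {S α t : ℝ} (hS : 1 ≤ S) (ht : 0 ≤ t) :
    logb 2 (1 + t * S / (1 + t * S ^ α)) ≤ 1 + max (1 - α) 0 * logb 2 S := by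
  have hS0 : 0 < S := by linarith
  have hSα : 0 < S ^ α := by positivity
  rw [← logb_two_rpow_mul_rpow hS0]
  refine logb_le_logb_of_le (by norm_num) (by positivity) ?_
  have h1 : (1 : ℝ) ≤ S ^ max (1 - α) 0 := one_le_rpow hS (le_max_right _ _)
  have h2 : S ^ (1 - α) ≤ S ^ max (1 - α) 0 := rpow_le_rpow_of_exponent_le hS (le_max_left _ _)
  have h3 : t * S / (1 + t * S ^ α) ≤ S ^ (1 - α) := by
    rw [rpow_sub hS0, rpow_one, div_le_div_iff₀ (by positivity) hSα]
    nlinarith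
  rw [rpow_one]
  linarith

/-- The received-power term is at most `3 + max(1, α) log₂ S`. -/
theorem logb_received_power_le {S α ρ : ℝ} (hS : 1 ≤ S) (hρ0 : 0 ≤ ρ) (hρ1 : ρ ≤ 1) :
    logb 2 (1 + S + S ^ α + 2 * ρ * S ^ ((1 + α) / 2)) ≤ 3 + max 1 α * logb 2 S := by
  have hS0 : 0 < S := by linarith
  rw [← logb_two_rpow_mul_rpow hS0]
  refine logb_le_logb_of_le (by norm_num) (by positivity) ?_
  have h1 : S ≤ S ^ max 1 α := by
    simpa using rpow_le_rpow_of_exponent_le hS (le_max_left 1 α)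
  have h2 : S ^ α ≤ S ^ max 1 α := rpow_le_rpow_of_exponent_le hS (le_max_right _ _)
  have h3 : S ^ ((1 + α) / 2) ≤ S ^ max 1 α :=
    rpow_le_rpow_of_exponent_le hS (by linarith [le_max_left 1 α, le_max_right 1 α])
  have h4 : ρ * S ^ ((1 + α) / 2) ≤ 1 * S ^ max 1 α :=
    mul_le_mul hρ1 h3 (by positivity) zero_le_one
  have h5 : (2 : ℝ) ^ (3 : ℝ) = 8 := by norm_num
  rw [h5]
  linarith

/-- The interference-limited rate term at `ρ = 0` is at least `-1 + (1 - α)⁺ log₂ S`. -/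
theorem le_logb_one_add_div {S α : ℝ} (hS : 1 ≤ S) (hα : 0 ≤ α) :
    -1 + max (1 - α) 0 * logb 2 S ≤ logb 2 (1 + S / (1 + S ^ α)) := by
  have hS0 : 0 < S := by linarith
  have hSα : 1 ≤ S ^ α := one_le_rpow hS hα
  rw [← logb_two_rpow_mul_rpow hS0]
  refine logb_le_logb_of_le (by norm_num) (by positivity) ?_
  rw [rpow_neg_one]
  have hq : 0 ≤ S / (1 + S ^ α) := by positivity
  rcases max_cases (1 - α) 0 with ⟨h, -⟩ | ⟨h, -⟩ <;> rw [h]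
  · have : 2⁻¹ * S ^ (1 - α) ≤ S / (1 + S ^ α) := by
      rw [rpow_sub hS0, rpow_one, ← div_eq_inv_mul, div_div]
      exact div_le_div_of_nonneg_left hS0.le (by positivity) (by linarith)
    linarith
  · rw [rpow_zero]
    linarith

/-- The received-power term at `ρ = 0` is at least `max(1, α) log₂ S`. -/
theorem le_logb_received_power {S : ℝ} (α : ℝ) (hS : 1 ≤ S) :
    max 1 α * logb 2 S ≤ logb 2 (1 + S + S ^ α) := by
  have hS0 : 0 < S := by linarith
  have hSα : 0 < S ^ α := by positivity
  rw [← logb_rpow_eq_mul_logb_of_pos hS0]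
  refine logb_le_logb_of_le (by norm_num) (by positivity) ?_
  rcases max_cases 1 α with ⟨h, -⟩ | ⟨h, -⟩ <;> rw [h]
  · rw [rpow_one]
    linarith
  · linarith

/-- The generalized degrees-of-freedom of the symmetric Gaussian interference
channel with feedback: with INR = SNR^α, the outer bound C̄(SNR), normalized by
log₂ SNR, converges to max(1 − α/2, α/2) as SNR → ∞. -/
theorem gdof_outer_bound (α : ℝ) (hα : 0 ≤ α) :
    Tendsto
      (fun SNR : ℝ =>
        ((1 / 2) * ⨆ ρ : Set.Icc (0 : ℝ) 1,
          (Real.logb 2 (1 + (1 - (ρ : ℝ) ^ 2) * SNR / (1 + (1 - (ρ : ℝ) ^ 2) * SNR ^ α)) +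
            Real.logb 2 (1 + SNR + SNR ^ α + 2 * (ρ : ℝ) * SNR ^ ((1 + α) / 2)))) /
          Real.logb 2 SNR)
      atTop (nhds (max (1 - α / 2) (α / 2))) := by
  set d := max (1 - α / 2) (α / 2) with hd
  have hsum : max (1 - α) 0 + max 1 α = 2 * d := by
    rw [hd]
    rcases le_total α 1 with h | h
    · rw [max_eq_left (by linarith), max_eq_left h, max_eq_left (by linarith)]
      ring
    · rw [max_eq_right (by linarith), max_eq_right h, max_eq_right (by linarith)]
      ring
  have hL : Tendsto (logb 2) atTop atTop := tendsto_logb_atTop (by norm_num)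
  have hlim (c : ℝ) : Tendsto (fun S => d + c / logb 2 S) atTop (nhds d) := by
    simpa using tendsto_const_nhds.add (hL.const_div_atTop c)
  refine tendsto_of_tendsto_of_tendsto_of_le_of_le' (hlim (-1 / 2)) (hlim 2) ?_ ?_
  all_goals
    filter_upwards [eventually_gt_atTop 1] with S hS
    have hLS : 0 < logb 2 S := logb_pos (by norm_num) hS
    have hub (ρ : Set.Icc (0 : ℝ) 1) :
        logb 2 (1 + (1 - (ρ : ℝ) ^ 2) * S / (1 + (1 - (ρ : ℝ) ^ 2) * S ^ α)) +
          logb 2 (1 + S + S ^ α + 2 * (ρ : ℝ) * S ^ ((1 + α) / 2)) ≤ 4 + 2 * d * logb 2 S := by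
      have ht : 0 ≤ 1 - (ρ : ℝ) ^ 2 := by nlinarith [ρ.2.1, ρ.2.2]
      have h1 := logb_one_add_div_le (α := α) hS.le ht
      have h2 := logb_received_power_le (α := α) hS.le ρ.2.1 ρ.2.2
      rw [← hsum]
      linarith
  · have h0 := le_ciSup ⟨_, Set.forall_mem_range.2 hub⟩ (⟨0, by simp⟩ : Set.Icc (0 : ℝ) 1)
    simp only [ne_eq, OfNat.ofNat_ne_zero, not_false_eq_true, zero_pow, sub_zero, one_mul,
      mul_zero, zero_mul, add_zero] at h0
    have h1 := le_logb_one_add_div hS.le hα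
    have h2 := le_logb_received_power α hS.le
    have h3 := congrArg (· * logb 2 S) hsum
    simp only [add_mul] at h3
    rw [le_div_iff₀ hLS, add_mul, div_mul_cancel₀ _ hLS.ne']
    linarith
  · have h0 := ciSup_le hub
    rw [div_le_iff₀ hLS, add_mul, div_mul_cancel₀ _ hLS.ne']
    linarith
end

section
/- Fix α > 0 and for SNR > 1 define the achievable symmetric rate R(SNR) by: R = (1/2)·log₂(1+SNR^α) if α ≥ 1, and R = log₂(1 + SNR^{1−α}/2) + (1/2)·log₂(1+SNR^α) − 1/2 if 0 < α < 1. Then lim_{SNR→∞} R(SNR)/log₂(SNR) = max(1 − α/2, α/2). -/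
open Real Filter

/-- The logarithm of `1 + x ^ b / c`, normalized by `logb a x`, tends to the exponent `b`. -/
theorem tendsto_logb_one_add_rpow_div_div_logb {a b c : ℝ} (ha : 1 < a) (hb : 0 < b) (hc : 0 < c) :
    Tendsto (fun x : ℝ => Real.logb a (1 + x ^ b / c) / Real.logb a x) atTop (nhds b) := by
  have h1 : Tendsto (fun x : ℝ => x ^ (-b) + 1 / c) atTop (nhds (0 + 1 / c)) :=
    (tendsto_rpow_neg_atTop hb).add_const _
  have h2 : Tendsto (fun x : ℝ => Real.logb a (x ^ (-b) + 1 / c)) atTop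
      (nhds (Real.logb a (0 + 1 / c))) :=
    ((Real.continuousAt_log (by positivity)).tendsto.comp h1).div_const _
  have h3 := (h2.div_atTop (Real.tendsto_logb_atTop ha)).const_add b
  rw [add_zero] at h3
  refine h3.congr' ?_
  filter_upwards [eventually_gt_atTop 1] with x hx
  have hx0 : 0 < x := by linarith
  have hlog : Real.logb a x ≠ 0 := (Real.logb_pos ha hx).ne'
  have hprod : 1 + x ^ b / c = x ^ b * (x ^ (-b) + 1 / c) := by
    rw [mul_add, ← Real.rpow_add hx0, add_neg_cancel, Real.rpow_zero]
    ring
  rw [hprod, Real.logb_mul (by positivity) (by positivity), Real.logb_rpow_eq_mul_logb_of_pos hx0,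
    add_div, mul_div_cancel_right₀ _ hlog]

/-- The two-staged feedback scheme achieves the full generalized
degrees-of-freedom: with INR = SNR^α, the achievable symmetric rate R(SNR) of
Theorem 2, normalized by log₂ SNR, converges to max(1 − α/2, α/2) as SNR → ∞. -/
theorem gdof_achievable (α : ℝ) (hα : 0 < α) :
    Tendsto
      (fun SNR : ℝ =>
        (if 1 ≤ α then (1 / 2) * Real.logb 2 (1 + SNR ^ α)
         else Real.logb 2 (1 + SNR ^ (1 - α) / 2) + (1 / 2) * Real.logb 2 (1 + SNR ^ α) - 1 / 2) /
          Real.logb 2 SNR)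
      atTop (nhds (max (1 - α / 2) (α / 2))) := by
  have hI : Tendsto (fun x : ℝ => Real.logb 2 (1 + x ^ α) / Real.logb 2 x) atTop (nhds α) := by
    simpa using tendsto_logb_one_add_rpow_div_div_logb one_lt_two hα one_pos
  split_ifs with h
  · rw [max_eq_right (by linarith)]
    convert hI.const_mul (1 / 2) using 2 <;> ring
  · push Not at h
    rw [max_eq_left (by linarith)]
    have hD := tendsto_logb_one_add_rpow_div_div_logb one_lt_two (sub_pos.2 h) two_pos
    have hC : Tendsto (fun x : ℝ => (1 / 2) / Real.logb 2 x) atTop (nhds 0) :=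
      (Real.tendsto_logb_atTop one_lt_two).const_div_atTop _
    convert (hD.add (hI.const_mul (1 / 2))).sub hC using 2 <;> ring
end

section
/- Let n, m be natural numbers, q = max(n,m), and let X₁, X₂ be random variables (on a common probability space, with any joint distribution) taking values in (ZMod 2)^q, viewed as column vectors of q bit levels. Let D : (ZMod 2)^q → (ZMod 2)^q be the down-shift map ((Dx)_1 = 0 and (Dx)_j = x_{j−1} for j ≥ 2). Define V₁ = D^{q−m} X₁, V₂ = D^{q−m} X₂, Y₁ = D^{q−n} X₁ + V₂ and Y₂ = D^{q−n} X₂ + V₁ (addition componentwise in ZMod 2). Then H[Y₁ | (V₁, V₂)] + H[Y₂] ≤ (max(n,m) + max(n−m, 0)) · log 2, where H denotes Shannon entropy (natural logarithm) and H[·|·] conditional Shannon entropy. -/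
open MeasureTheory

/-- Shannon entropy (in nats) of a random variable `X` with values in a
finite type, with respect to the measure `μ`. -/
noncomputable def shannonEntropy {Ω S : Type*} [MeasurableSpace Ω] [Fintype S]
    (μ : Measure Ω) (X : Ω → S) : ℝ :=
  ∑ s : S, Real.negMulLog (μ (X ⁻¹' {s})).toReal

/-- Conditional Shannon entropy `H[X | Z] = H[(X,Z)] − H[Z]` (in nats). -/
noncomputable def condShannonEntropy {Ω S T : Type*} [MeasurableSpace Ω]
    [Fintype S] [Fintype T] (μ : Measure Ω) (X : Ω → S) (Z : Ω → T) : ℝ :=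
  shannonEntropy μ (fun ω => (X ω, Z ω)) - shannonEntropy μ Z

/-- The down-shift map on `q` bit levels: `(D x)₀ = 0` and `(D x)ⱼ = x_{j−1}`. -/
def downShift (q : ℕ) (x : Fin q → ZMod 2) : Fin q → ZMod 2 :=
  fun j => if h : (j : ℕ) = 0 then 0 else x ⟨(j : ℕ) - 1, by omega⟩

/-- Jensen's inequality for `Real.negMulLog` over a finite set with at most `K` elements. -/
theorem sum_negMulLog_le {S : Type*} (A : Finset S) (a : S → ℝ) (ha : ∀ s, 0 ≤ a s)
    {K : ℕ} (hK : A.card ≤ K) :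
    ∑ s ∈ A, Real.negMulLog (a s) ≤
      Real.negMulLog (∑ s ∈ A, a s) + (∑ s ∈ A, a s) * Real.log K := by
  rcases A.eq_empty_or_nonempty with rfl | hA
  · simp
  have hN : (0 : ℝ) < A.card := by exact_mod_cast hA.card_pos
  have hP : 0 ≤ ∑ s ∈ A, a s := Finset.sum_nonneg fun s _ => ha s
  have jensen := Real.concaveOn_negMulLog.le_map_sum (t := A) (w := fun _ => (A.card : ℝ)⁻¹)
    (p := a) (fun _ _ => by positivity) (by simp [hN.ne']) (fun s _ => ha s)
  simp only [smul_eq_mul, ← Finset.mul_sum] at jensen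
  have hlog : Real.log A.card ≤ Real.log K := Real.log_le_log hN (by exact_mod_cast hK)
  have hmul := mul_le_mul_of_nonneg_left hlog hP
  have hinv : Real.negMulLog (A.card : ℝ)⁻¹ = (A.card : ℝ)⁻¹ * Real.log A.card := by
    simp [Real.negMulLog, Real.log_inv]
  rw [Real.negMulLog_mul, hinv] at jensen
  have key := mul_le_mul_of_nonneg_left jensen hN.le
  field_simp at key
  linarith

/-- The entropy of a random variable with finitely many values is at most the logarithm of
their number. -/
theorem shannonEntropy_le_log_card {Ω S : Type*} [MeasurableSpace Ω] [Fintype S]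
    [MeasurableSpace S] [MeasurableSingletonClass S] (μ : Measure Ω) [IsProbabilityMeasure μ]
    {X : Ω → S} (hX : Measurable X) :
    shannonEntropy μ X ≤ Real.log (Fintype.card S) := by
  have hsum : ∑ s : S, (μ (X ⁻¹' {s})).toReal = 1 := by
    have h := sum_measureReal_preimage_singleton (μ := μ) (f := X) Finset.univ
      fun s _ => hX (measurableSet_singleton s)
    simpa [measureReal_def] using h
  have h := sum_negMulLog_le Finset.univ (fun s => (μ (X ⁻¹' {s})).toReal)
    (fun _ => ENNReal.toReal_nonneg) (Finset.card_univ (α := S)).le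
  simpa [hsum, shannonEntropy] using h

/-- If, for every value `z` of `Z`, the variable `X` takes at most `K` values on `{Z = z}`, then
`H[X | Z] ≤ log K`. -/
theorem condShannonEntropy_le_log {Ω S T : Type*} [MeasurableSpace Ω] [Fintype S] [Fintype T]
    [MeasurableSpace S] [MeasurableSingletonClass S]
    [MeasurableSpace T] [MeasurableSingletonClass T]
    (μ : Measure Ω) [IsProbabilityMeasure μ] {X : Ω → S} {Z : Ω → T}
    (hX : Measurable X) (hZ : Measurable Z) (A : T → Finset S) (hA : ∀ ω, X ω ∈ A (Z ω))
    {K : ℕ} (hK : ∀ z, (A z).card ≤ K) :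
    condShannonEntropy μ X Z ≤ Real.log K := by
  set p : S → T → ℝ := fun s z => (μ ((fun ω => (X ω, Z ω)) ⁻¹' {(s, z)})).toReal with hp
  have hzero : ∀ z, ∀ s ∉ A z, p s z = 0 := by
    intro z s hs
    have hempty : (fun ω => (X ω, Z ω)) ⁻¹' {(s, z)} = ∅ := by
      ext ω
      simp only [Set.mem_preimage, Set.mem_singleton_iff, Prod.mk.injEq, Set.mem_empty_iff_false,
        iff_false, not_and]
      rintro rfl rfl
      exact hs (hA ω)
    simp [hp, hempty]
  have hmarg : ∀ z, ∑ s ∈ A z, p s z = (μ (Z ⁻¹' {z})).toReal := by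
    intro z
    have h := sum_measureReal_preimage_singleton (μ := μ) (f := fun ω => (X ω, Z ω))
      (A z ×ˢ {z}) fun y _ => (hX.prodMk hZ) (measurableSet_singleton y)
    rw [Finset.sum_product] at h
    simp only [Finset.sum_singleton, measureReal_def] at h
    rw [hp, h]
    congr 2
    ext ω
    simp only [Finset.coe_product, Finset.coe_singleton, Set.mem_preimage, Set.mem_prod,
      Finset.mem_coe, Set.mem_singleton_iff, and_iff_right_iff_imp]
    rintro rfl
    exact hA ω
  have hsum : ∑ z : T, (μ (Z ⁻¹' {z})).toReal = 1 := by
    have h := sum_measureReal_preimage_singleton (μ := μ) (f := Z) Finset.univ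
      fun z _ => hZ (measurableSet_singleton z)
    simpa [measureReal_def] using h
  have hfiber : ∀ z, ∑ s, Real.negMulLog (p s z) ≤
      Real.negMulLog (μ (Z ⁻¹' {z})).toReal + (μ (Z ⁻¹' {z})).toReal * Real.log K := by
    intro z
    rw [← Finset.sum_subset (Finset.subset_univ (A z))
      fun s _ hs => by rw [hzero z s hs, Real.negMulLog_zero], ← hmarg z]
    exact sum_negMulLog_le (A z) (fun s => p s z) (fun _ => ENNReal.toReal_nonneg) (hK z)
  have h := Finset.sum_le_sum fun z (_ : z ∈ Finset.univ) => hfiber z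
  rw [Finset.sum_add_distrib, ← Finset.sum_mul, hsum, one_mul] at h
  rw [condShannonEntropy, shannonEntropy, shannonEntropy, Fintype.sum_prod_type_right]
  linarith

theorem downShift_iterate_apply (q k : ℕ) (x : Fin q → ZMod 2) (j : Fin q) :
    (downShift q)^[k] x j = if (j : ℕ) < k then 0 else x ⟨j - k, by omega⟩ := by
  induction k generalizing j with
  | zero => simp
  | succ k ih =>
    rw [Function.iterate_succ_apply', downShift]
    split_ifs with h₀ h₁ h₁
    · rfl
    · omega
    · rw [ih, if_pos (by simp only; omega)]
    · rw [ih, if_neg (by simp only; omega)]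
      congr 2
      simp only
      omega

/-- The outputs of the direct link compatible with a given output of the cross link number at
most `2 ^ (n - m)`. -/
theorem card_image_downShift_fiber_le (n m : ℕ) (v w : Fin (max n m) → ZMod 2) :
    ((Finset.univ.filter fun x => (downShift (max n m))^[max n m - m] x = v).image
      fun x => (downShift (max n m))^[max n m - n] x + w).card ≤ 2 ^ (n - m) := by
  have hcard : (Finset.univ : Finset (Fin (n - m) → ZMod 2)).card = 2 ^ (n - m) := by
    simp [ZMod.card]
  rw [← hcard]
  refine Finset.card_le_card_of_injOn
    (fun y i => y ⟨m + i, by omega⟩) (fun _ _ => Finset.mem_coe.2 (Finset.mem_univ _)) ?_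
  intro y hy y' hy' hyy'
  simp only [Finset.coe_image, Finset.coe_filter, Finset.mem_univ, true_and, Set.mem_image,
    Set.mem_ofPred_eq] at hy hy'
  obtain ⟨x, hx, rfl⟩ := hy
  obtain ⟨x', hx', rfl⟩ := hy'
  have hxx' := hx.trans hx'.symm
  ext1 j
  by_cases hj : m ≤ (j : ℕ)
  · have h := congrFun hyy' ⟨j - m, by omega⟩
    simpa [Nat.add_sub_cancel' hj] using h
  · simp only [Pi.add_apply, downShift_iterate_apply]
    split_ifs with hlt
    · rfl
    · have h := congrFun hxx' ⟨j - (max n m - n) + (max n m - m), by omega⟩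
      simp only [downShift_iterate_apply, Nat.add_sub_cancel] at h
      rw [if_neg (by omega), if_neg (by omega)] at h
      rw [h]

/-- Core of the converse of Theorem 1 (linear deterministic interference
channel with feedback): for any joint distribution of the inputs `X₁, X₂`,
`H[Y₁ | (V₁,V₂)] + H[Y₂] ≤ (max(n,m) + (n−m)⁺) · log 2`. -/
theorem det_converse_entropy_bound (n m : ℕ) {Ω : Type*} [MeasurableSpace Ω]
    (μ : Measure Ω) [IsProbabilityMeasure μ]
    (X₁ X₂ : Ω → (Fin (max n m) → ZMod 2))
    (hX₁ : Measurable X₁) (hX₂ : Measurable X₂)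
    (V₁ V₂ Y₁ Y₂ : Ω → (Fin (max n m) → ZMod 2))
    (hV₁ : V₁ = fun ω => (downShift (max n m))^[max n m - m] (X₁ ω))
    (hV₂ : V₂ = fun ω => (downShift (max n m))^[max n m - m] (X₂ ω))
    (hY₁ : Y₁ = fun ω => (downShift (max n m))^[max n m - n] (X₁ ω) + V₂ ω)
    (hY₂ : Y₂ = fun ω => (downShift (max n m))^[max n m - n] (X₂ ω) + V₁ ω) :
    condShannonEntropy μ Y₁ (fun ω => (V₁ ω, V₂ ω)) + shannonEntropy μ Y₂ ≤
      ((max n m + (n - m) : ℕ) : ℝ) * Real.log 2 := by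
  have hshift : ∀ k, Measurable (downShift (max n m))^[k] := fun k => measurable_of_finite _
  have mV₁ : Measurable V₁ := hV₁ ▸ (hshift _).comp hX₁
  have mV₂ : Measurable V₂ := hV₂ ▸ (hshift _).comp hX₂
  have hadd : Measurable fun y : (Fin (max n m) → ZMod 2) × (Fin (max n m) → ZMod 2) =>
      y.1 + y.2 := measurable_of_finite _
  have mY₁ : Measurable Y₁ := hY₁ ▸ hadd.comp (((hshift _).comp hX₁).prodMk mV₂)
  have mY₂ : Measurable Y₂ := hY₂ ▸ hadd.comp (((hshift _).comp hX₂).prodMk mV₁)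
  have hcond := condShannonEntropy_le_log μ mY₁ (mV₁.prodMk mV₂)
    (fun z => (Finset.univ.filter fun x => (downShift (max n m))^[max n m - m] x = z.1).image
      fun x => (downShift (max n m))^[max n m - n] x + z.2)
    (fun ω => Finset.mem_image.2 ⟨X₁ ω, by simp [hV₁], by simp [hY₁]⟩)
    (fun z => card_image_downShift_fiber_le n m z.1 z.2)
  have hunif := shannonEntropy_le_log_card μ mY₂
  simp only [Fintype.card_fun, ZMod.card, Fintype.card_fin, Nat.cast_pow, Nat.cast_ofNat,
    Real.log_pow] at hcond hunif
  rw [Nat.cast_add, add_mul]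
  linarith
end

section
/- Fix α ≥ 0 and suppose ρ* : (1,∞) → [0,1] satisfies, for every S > 1, the equation 2·S^{(3α+1)/2}·ρ*(S)⁴ + S^α·ρ*(S)³ − 4·(S^{(3α+1)/2} + S^{(α+1)/2})·ρ*(S)² − (2 + S + 2·S^α)·ρ*(S) + 2·(S^{(3α+1)/2} + S^{(α+1)/2}) = 0. Define R(S) = log₂((1 + S + S^α + 2·ρ*(S)·S^{(α+1)/2})/(1 + (1−ρ*(S)²)·S^α)). Then lim_{S→∞} R(S)/log₂(S) equals 1−α if 0 ≤ α < 1/3, equals (3−α)/4 if 1/3 ≤ α < 1, and equals (1+α)/4 if α ≥ 1. -/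
open Real Filter

/-- A function squeezed between two positive multiples of `x ^ p` has logarithmic order `p`. -/
lemma tendsto_logb_div_logb_of_rpow_bounds {f : ℝ → ℝ} {b p c C : ℝ} (hb : 1 < b) (hc : 0 < c)
    (hlow : ∀ᶠ x in atTop, c * x ^ p ≤ f x) (hupp : ∀ᶠ x in atTop, f x ≤ C * x ^ p) :
    Tendsto (fun x => Real.logb b (f x) / Real.logb b x) atTop (nhds p) := by
  have hlog : Tendsto (fun x => Real.logb b x) atTop atTop := Real.tendsto_logb_atTop hb
  have hlim (k : ℝ) : Tendsto (fun x => k / Real.logb b x + p) atTop (nhds p) := by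
    simpa using (hlog.const_div_atTop k).add_const p
  refine tendsto_of_tendsto_of_tendsto_of_le_of_le' (hlim (Real.logb b c)) (hlim (Real.logb b C))
    ?_ ?_
  · filter_upwards [hlow, eventually_gt_atTop 1] with x hx h1
    have hx0 : 0 < x := by linarith
    have hxp : 0 < x ^ p := Real.rpow_pos_of_pos hx0 p
    have hl : 0 < Real.logb b x := Real.logb_pos hb h1
    have h := Real.logb_le_logb_of_le hb (by positivity) hx
    rw [Real.logb_mul hc.ne' hxp.ne', Real.logb_rpow_eq_mul_logb_of_pos hx0] at h
    rw [le_div_iff₀ hl, add_mul, div_mul_cancel₀ _ hl.ne']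
    exact h
  · filter_upwards [hlow, hupp, eventually_gt_atTop 1] with x hx hx' h1
    have hx0 : 0 < x := by linarith
    have hxp : 0 < x ^ p := Real.rpow_pos_of_pos hx0 p
    have hl : 0 < Real.logb b x := Real.logb_pos hb h1
    have hf : 0 < f x := lt_of_lt_of_le (by positivity) hx
    have hC : 0 < C := pos_of_mul_pos_left (hf.trans_le hx') hxp.le
    have h := Real.logb_le_logb_of_le hb hf hx'
    rw [Real.logb_mul hC.ne' hxp.ne', Real.logb_rpow_eq_mul_logb_of_pos hx0] at h
    rw [div_le_iff₀ hl, add_mul, div_mul_cancel₀ _ hl.ne']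
    exact h

/-- The quartic in terms of the denominator `D = 1 + (1 - ρ²) a` of the rate. -/
lemma two_mul_sq_denom_eq {S a t ρ : ℝ} (ha : a = t ^ 2 * S)
    (h : 2 * (a * (t * S)) * ρ ^ 4 + a * ρ ^ 3 - 4 * (a * (t * S) + t * S) * ρ ^ 2 -
      (2 + S + 2 * a) * ρ + 2 * (a * (t * S) + t * S) = 0) :
    2 * (1 + (1 - ρ ^ 2) * a) ^ 2 =
      2 + 2 * a + t * ρ * (1 + (1 - ρ ^ 2) * a + (1 + S + a)) := by
  subst ha
  linear_combination t * h

/-- Bounds on the squared denominator of the rate, where `M` plays the role of `max S a`. -/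
lemma sq_denom_bounds {S a t M ρ : ℝ} (hρ0 : 0 ≤ ρ) (hρ1 : ρ ≤ 1) (ha1 : 1 ≤ a) (ht : 0 ≤ t)
    (hSM : S ≤ M) (haM : a ≤ M) (hM : M ≤ S + a) (hatM : a ≤ t * M)
    (h : 2 * (1 + (1 - ρ ^ 2) * a) ^ 2 =
      2 + 2 * a + t * ρ * (1 + (1 - ρ ^ 2) * a + (1 + S + a))) :
    (1 + (1 - ρ ^ 2) * a) ^ 2 ≤ 5 * (t * M) ∧
    (1 + (1 - ρ ^ 2) * a) ^ 2 ≤ 4 * a ^ 2 ∧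
    (1 / 4 * a ^ 2 ≤ (1 + (1 - ρ ^ 2) * a) ^ 2 ∨
      1 / 4 * (t * M) ≤ (1 + (1 - ρ ^ 2) * a) ^ 2) := by
  have hu0 : 0 ≤ (1 - ρ ^ 2) * a := mul_nonneg (by nlinarith) (by linarith)
  have hu1 : (1 - ρ ^ 2) * a ≤ a := by nlinarith [sq_nonneg ρ]
  refine ⟨?_, ?_, ?_⟩
  · have h1 : t * ρ ≤ t := mul_le_of_le_one_right ht hρ1
    have h2 : t * ρ * (1 + (1 - ρ ^ 2) * a + (1 + S + a)) ≤ t * (6 * M) :=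
      mul_le_mul h1 (by linarith) (by linarith) ht
    linarith
  · nlinarith
  · rcases le_total ρ (1 / 2) with hρ | hρ
    · left
      have h1 : 1 / 2 * a ≤ (1 - ρ ^ 2) * a :=
        mul_le_mul_of_nonneg_right (by nlinarith) (by linarith)
      nlinarith
    · right
      have h1 : t * (1 / 2) ≤ t * ρ := mul_le_mul_of_nonneg_left hρ ht
      have h2 : t * (1 / 2) * M ≤ t * ρ * (1 + (1 - ρ ^ 2) * a + (1 + S + a)) :=
        mul_le_mul h1 (by linarith) (by linarith) (by positivity)
      linarith

/-- Lemma 1: the generalized degrees-of-freedom of Kramer's feedback scheme.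
If ρ*(S) ∈ [0,1] solves the quartic for every S > 1, then the normalized
symmetric rate of Kramer's scheme converges to 1−α on [0,1/3), to (3−α)/4 on
[1/3,1), and to (1+α)/4 on [1,∞). -/
theorem kramer_gdof (α : ℝ) (hα : 0 ≤ α) (ρstar : ℝ → ℝ)
    (hmem : ∀ S : ℝ, 1 < S → ρstar S ∈ Set.Icc (0 : ℝ) 1)
    (hroot : ∀ S : ℝ, 1 < S →
      2 * S ^ ((3 * α + 1) / 2) * ρstar S ^ 4 + S ^ α * ρstar S ^ 3 -
        4 * (S ^ ((3 * α + 1) / 2) + S ^ ((α + 1) / 2)) * ρstar S ^ 2 -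
        (2 + S + 2 * S ^ α) * ρstar S +
        2 * (S ^ ((3 * α + 1) / 2) + S ^ ((α + 1) / 2)) = 0) :
    Tendsto
      (fun S : ℝ =>
        Real.logb 2 ((1 + S + S ^ α + 2 * ρstar S * S ^ ((α + 1) / 2)) /
            (1 + (1 - ρstar S ^ 2) * S ^ α)) / Real.logb 2 S)
      atTop
      (nhds (if α < 1 / 3 then 1 - α else if α < 1 then (3 - α) / 4 else (1 + α) / 4)) := by
  set D : ℝ → ℝ := fun S => 1 + (1 - ρstar S ^ 2) * S ^ α with hD
  set N : ℝ → ℝ := fun S => 1 + S + S ^ α + 2 * ρstar S * S ^ ((α + 1) / 2) with hN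
  set m : ℝ := max 1 α with hm
  have hm1 : 1 ≤ m := le_max_left _ _
  have hmα : α ≤ m := le_max_right _ _
  have hmax : m = 1 ∨ m = α := max_choice 1 α
  have hDpos (S : ℝ) (hS : 1 < S) : 0 < D S := by
    have hρ := hmem S hS
    have h1 : 0 ≤ 1 - ρstar S ^ 2 := by nlinarith [hρ.1, hρ.2]
    have h2 : 0 < S ^ α := Real.rpow_pos_of_pos (by linarith) α
    simp only [hD]
    positivity
  have hNlow (S : ℝ) (hS : 1 < S) : 1 * S ^ m ≤ N S := by
    have hS0 : 0 < S := by linarith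
    have hρ := (hmem S hS).1
    have h2 : 0 < S ^ α := Real.rpow_pos_of_pos hS0 α
    have h3 : 0 ≤ 2 * ρstar S * S ^ ((α + 1) / 2) := by positivity
    simp only [hN]
    rcases hmax with h | h <;> rw [h]
    · rw [Real.rpow_one]; linarith
    · linarith
  have hNupp (S : ℝ) (hS : 1 < S) : N S ≤ 5 * S ^ m := by
    have hρ := hmem S hS
    have h1 : 1 ≤ S ^ m := Real.one_le_rpow hS.le (by linarith)
    have h2 : S ^ α ≤ S ^ m := Real.rpow_le_rpow_of_exponent_le hS.le hmα
    have h3 : S ≤ S ^ m := Real.self_le_rpow_of_one_le hS.le hm1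
    have h4 : S ^ ((α + 1) / 2) ≤ S ^ m :=
      Real.rpow_le_rpow_of_exponent_le hS.le (by linarith)
    have h5 : ρstar S * S ^ ((α + 1) / 2) ≤ 1 * S ^ m :=
      mul_le_mul hρ.2 h4 (Real.rpow_nonneg (by linarith) _) zero_le_one
    simp only [hN]
    linarith
  have hDsq (S : ℝ) (hS : 1 < S) :
      D S ^ 2 ≤ 5 * S ^ ((α - 1) / 2 + m) ∧ D S ^ 2 ≤ 4 * S ^ (2 * α) ∧
      (1 / 4 * S ^ (2 * α) ≤ D S ^ 2 ∨ 1 / 4 * S ^ ((α - 1) / 2 + m) ≤ D S ^ 2) := by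
    have hS0 : 0 < S := by linarith
    have hρ := hmem S hS
    have e1 : S ^ ((α + 1) / 2) = S ^ ((α - 1) / 2) * S := by
      rw [← Real.rpow_add_one hS0.ne']; ring_nf
    have e2 : S ^ ((3 * α + 1) / 2) = S ^ α * (S ^ ((α - 1) / 2) * S) := by
      rw [← e1, ← Real.rpow_add hS0]; ring_nf
    have e3 : S ^ α = (S ^ ((α - 1) / 2)) ^ 2 * S := by
      rw [← Real.rpow_mul_natCast hS0.le, ← Real.rpow_add_one hS0.ne']
      push_cast; ring_nf
    have e4 : S ^ (2 * α) = (S ^ α) ^ 2 := by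
      rw [← Real.rpow_mul_natCast hS0.le]
      push_cast; ring_nf
    have h := hroot S hS
    rw [e1, e2] at h
    rw [e4, Real.rpow_add hS0]
    refine sq_denom_bounds hρ.1 hρ.2 (Real.one_le_rpow hS.le hα) (Real.rpow_nonneg hS0.le _)
      (Real.self_le_rpow_of_one_le hS.le hm1) (Real.rpow_le_rpow_of_exponent_le hS.le hmα) ?_ ?_
      (two_mul_sq_denom_eq e3 h)
    · have h2 : 0 < S ^ α := Real.rpow_pos_of_pos hS0 α
      rcases hmax with h | h <;> rw [h]
      · rw [Real.rpow_one]; linarith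
      · linarith
    · rw [← Real.rpow_add hS0]
      exact Real.rpow_le_rpow_of_exponent_le hS.le (by linarith)
  have key {q : ℝ} (hlow : ∀ᶠ S in atTop, 1 / 4 * S ^ q ≤ D S ^ 2)
      (hupp : ∀ᶠ S in atTop, D S ^ 2 ≤ 5 * S ^ q) :
      Tendsto (fun S => Real.logb 2 (N S / D S) / Real.logb 2 S) atTop (nhds (m - q / 2)) := by
    have hNlim : Tendsto (fun S => Real.logb 2 (N S) / Real.logb 2 S) atTop (nhds m) :=
      tendsto_logb_div_logb_of_rpow_bounds one_lt_two one_pos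
        ((eventually_gt_atTop 1).mono hNlow) ((eventually_gt_atTop 1).mono hNupp)
    have hDlim := tendsto_logb_div_logb_of_rpow_bounds one_lt_two (by norm_num) hlow hupp
    refine (hNlim.sub (hDlim.div_const 2)).congr' ?_
    filter_upwards [eventually_gt_atTop 1] with S hS
    have hNpos : 0 < N S :=
      lt_of_lt_of_le (mul_pos one_pos (Real.rpow_pos_of_pos (by linarith) _)) (hNlow S hS)
    rw [Real.logb_div hNpos.ne' (hDpos S hS).ne', Real.logb_pow]
    push_cast
    ring
  rcases lt_or_ge α (1 / 3) with h3 | h3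
  · have hm_eq : m = 1 := max_eq_left (by linarith)
    have hgap : ∀ᶠ S : ℝ in atTop, 16 * S ^ (2 * α) < S ^ ((α - 1) / 2 + m) := by
      have hpos : 0 < (α - 1) / 2 + m - 2 * α := by linarith
      filter_upwards [(tendsto_rpow_atTop hpos).eventually_gt_atTop 16, eventually_gt_atTop 0]
        with S hS hS0
      rw [Real.rpow_sub hS0, lt_div_iff₀ (Real.rpow_pos_of_pos hS0 _)] at hS
      exact hS
    have h := key (q := 2 * α)
      (by
        filter_upwards [hgap, eventually_gt_atTop 1] with S hg hS
        obtain ⟨-, hu, hl | hl⟩ := hDsq S hS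
        · exact hl
        · linarith)
      (by
        filter_upwards [eventually_gt_atTop 1] with S hS
        have h2 : 0 < S ^ (2 * α) := Real.rpow_pos_of_pos (by linarith) _
        linarith [(hDsq S hS).2.1])
    rw [if_pos h3]
    convert h using 2
    rw [hm_eq]; ring
  · have h := key (q := (α - 1) / 2 + m)
      (by
        filter_upwards [eventually_gt_atTop 1] with S hS
        obtain ⟨-, -, hl | hl⟩ := hDsq S hS
        · have : S ^ ((α - 1) / 2 + m) ≤ S ^ (2 * α) :=
            Real.rpow_le_rpow_of_exponent_le hS.le (by rcases hmax with h | h <;> linarith)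
          linarith
        · exact hl)
      ((eventually_gt_atTop 1).mono fun S hS => (hDsq S hS).1)
    rw [if_neg h3.not_gt]
    convert h using 2
    split_ifs with h1
    · rw [show m = 1 from max_eq_left h1.le]; ring
    · rw [show m = α from max_eq_right (not_lt.mp h1)]; ring
end

section
/- Let W₁, W₂, U be finite types and let p : W₁ × W₂ × U → ℝ be a probability mass function (p ≥ 0 and sums to 1). Suppose that for all w₁, w₁' ∈ W₁, all w₂, w₂' ∈ W₂ and all u ∈ U: p(w₁,w₂,u)·p(w₁',w₂',u) = p(w₁',w₂,u)·p(w₁,w₂',u). Then for every u ∈ U with p_U(u) := Σ_{w₁,w₂} p(w₁,w₂,u) > 0 and all w₁ ∈ W₁, w₂ ∈ W₂: p(w₁,w₂,u)·p_U(u) = (Σ_{w₂'} p(w₁,w₂',u))·(Σ_{w₁'} p(w₁',w₂,u)). In other words, W₁ and W₂ are conditionally independent given U. -/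
/-- Willems' dependence-balance technique (core of Claim 7): if a joint pmf
`p` on `W₁ × W₂ × U` satisfies the cross-product identity
`p(w₁,w₂,u)·p(w₁',w₂',u) = p(w₁',w₂,u)·p(w₁,w₂',u)`, then `W₁` and `W₂` are
conditionally independent given `U`. -/
theorem conditional_independence_of_cross_identity
    {W₁ W₂ U : Type*} [Fintype W₁] [Fintype W₂] [Fintype U]
    (p : W₁ × W₂ × U → ℝ) (hnonneg : ∀ x, 0 ≤ p x)
    (hsum : ∑ x : W₁ × W₂ × U, p x = 1)
    (hcross : ∀ (w₁ w₁' : W₁) (w₂ w₂' : W₂) (u : U),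
      p (w₁, w₂, u) * p (w₁', w₂', u) = p (w₁', w₂, u) * p (w₁, w₂', u)) :
    ∀ u : U, 0 < ∑ w₁ : W₁, ∑ w₂ : W₂, p (w₁, w₂, u) →
      ∀ (w₁ : W₁) (w₂ : W₂),
        p (w₁, w₂, u) * (∑ w₁' : W₁, ∑ w₂' : W₂, p (w₁', w₂', u)) =
          (∑ w₂' : W₂, p (w₁, w₂', u)) * (∑ w₁' : W₁, p (w₁', w₂, u)) := by
  intro u _ w₁ w₂
  rw [mul_comm (∑ w₂' : W₂, p (w₁, w₂', u)), Finset.sum_mul_sum, Finset.mul_sum]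
  refine Finset.sum_congr rfl fun w₁' _ => ?_
  rw [Finset.mul_sum]
  exact Finset.sum_congr rfl fun w₂' _ => hcross w₁ w₁' w₂ w₂' u
end
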